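/- (Theorem 1.5, classification of eigenfunctions.) Let n ≥ 2, let β ≥ 0 and ς be real numbers, and let u be a nonzero smooth function on an open set containing the closed unit ball of ℝⁿ satisfying: Δ²u = 0 on the open unit ball 𝔹; ℰu(y) = 0 for every y on the unit sphere ∂𝔹; and ℰ(Δu)(y) + β(Δu(y) − ℰ²u(y)) + ς·u(y) = 0 for every y ∈ ∂𝔹. Then there exist a nonnegative integer k and a harmonic homogeneous polynomial w_k of degree k on ℝⁿ such that ς = k²(n + 2k) + βk(k + n − 2) and u(x) = −2w_k(x) + k(|x|² − 1)w_k(x) for every x in the closed unit ball. -/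

import Mathlib

/-- The Euclidean Laplacian `Δf(x) = ∑ i, ∂²f/∂xᵢ²(x)`. -/
noncomputable def lap {n : ℕ} (f : EuclideanSpace ℝ (Fin n) → ℝ)
    (x : EuclideanSpace ℝ (Fin n)) : ℝ :=
  ∑ i : Fin n,
    fderiv ℝ (fun y => fderiv ℝ f y (EuclideanSpace.single i 1)) x (EuclideanSpace.single i 1)

/-- The Euler operator `ℰf(x) = ∑ i, xᵢ ∂f/∂xᵢ(x) = ⟨x, ∇f(x)⟩ = df_x(x)`. -/
noncomputable def euler {n : ℕ} (f : EuclideanSpace ℝ (Fin n) → ℝ)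
    (x : EuclideanSpace ℝ (Fin n)) : ℝ :=
  fderiv ℝ f x x

open scoped ContDiff

/-- The `i`-th partial derivative. -/
noncomputable def partialDeriv {n : ℕ} (i : Fin n) (f : EuclideanSpace ℝ (Fin n) → ℝ)
    (x : EuclideanSpace ℝ (Fin n)) : ℝ :=
  fderiv ℝ f x (EuclideanSpace.single i 1)

section Operators

variable {n : ℕ} {f g : EuclideanSpace ℝ (Fin n) → ℝ}

theorem lap_eq_sum_partialDeriv (f : EuclideanSpace ℝ (Fin n) → ℝ)
    (x : EuclideanSpace ℝ (Fin n)) :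
    lap f x = ∑ i, partialDeriv i (partialDeriv i f) x := rfl

theorem euler_eq_sum_partialDeriv (f : EuclideanSpace ℝ (Fin n) → ℝ)
    (x : EuclideanSpace ℝ (Fin n)) :
    euler f x = ∑ i, x i * partialDeriv i f x := by
  have hx : x = ∑ i, x i • EuclideanSpace.single i (1 : ℝ) := by
    simpa using ((EuclideanSpace.basisFun (Fin n) ℝ).sum_repr x).symm
  unfold euler partialDeriv
  calc fderiv ℝ f x x = fderiv ℝ f x (∑ i, x i • EuclideanSpace.single i (1 : ℝ)) := by rw [← hx]
    _ = _ := by simp only [map_sum, map_smul, smul_eq_mul]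

theorem contDiff_partialDeriv (hf : ContDiff ℝ ∞ f) (i : Fin n) :
    ContDiff ℝ ∞ (partialDeriv i f) :=
  (hf.fderiv_right (m := ∞) (by simp)).clm_apply contDiff_const

theorem contDiff_lap (hf : ContDiff ℝ ∞ f) : ContDiff ℝ ∞ (lap f) :=
  ContDiff.sum fun i _ => contDiff_partialDeriv (contDiff_partialDeriv hf i) i

theorem contDiff_euler (hf : ContDiff ℝ ∞ f) : ContDiff ℝ ∞ (euler f) :=
  (hf.fderiv_right (m := ∞) (by simp)).clm_apply contDiff_id

theorem differentiable_of_smooth (hf : ContDiff ℝ ∞ f) : Differentiable ℝ f :=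
  hf.differentiable (by simp)

theorem partialDeriv_add (hf : Differentiable ℝ f) (hg : Differentiable ℝ g) (i : Fin n) :
    partialDeriv i (fun x => f x + g x) = fun x => partialDeriv i f x + partialDeriv i g x := by
  funext x
  simp [partialDeriv, fderiv_fun_add (hf x) (hg x)]

theorem partialDeriv_const_mul (hf : Differentiable ℝ f) (c : ℝ) (i : Fin n) :
    partialDeriv i (fun x => c * f x) = fun x => c * partialDeriv i f x := by
  funext x
  simp [partialDeriv, fderiv_const_mul (hf x)]

theorem partialDeriv_mul (hf : Differentiable ℝ f) (hg : Differentiable ℝ g) (i : Fin n) :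
    partialDeriv i (fun x => f x * g x) =
      fun x => f x * partialDeriv i g x + partialDeriv i f x * g x := by
  funext x
  simp [partialDeriv, fderiv_fun_mul (hf x) (hg x), mul_comm]

theorem euler_add (hf : Differentiable ℝ f) (hg : Differentiable ℝ g) :
    euler (fun x => f x + g x) = fun x => euler f x + euler g x := by
  funext x
  simp [euler, fderiv_fun_add (hf x) (hg x)]

theorem euler_const_mul (hf : Differentiable ℝ f) (c : ℝ) :
    euler (fun x => c * f x) = fun x => c * euler f x := by
  funext x
  simp [euler, fderiv_const_mul (hf x)]

theorem euler_mul (hf : Differentiable ℝ f) (hg : Differentiable ℝ g) :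
    euler (fun x => f x * g x) = fun x => f x * euler g x + euler f x * g x := by
  funext x
  simp [euler, fderiv_fun_mul (hf x) (hg x), mul_comm]

theorem euler_sum {ι : Type*} (s : Finset ι) (F : ι → EuclideanSpace ℝ (Fin n) → ℝ)
    (hF : ∀ i ∈ s, Differentiable ℝ (F i)) :
    euler (fun x => ∑ i ∈ s, F i x) = fun x => ∑ i ∈ s, euler (F i) x := by
  funext x
  simp [euler, fderiv_fun_sum fun i hi => hF i hi x]

theorem lap_add (hf : ContDiff ℝ ∞ f) (hg : ContDiff ℝ ∞ g) :
    lap (fun x => f x + g x) = fun x => lap f x + lap g x := by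
  funext x
  simp only [lap_eq_sum_partialDeriv, ← Finset.sum_add_distrib]
  refine Finset.sum_congr rfl fun i _ => ?_
  rw [partialDeriv_add (differentiable_of_smooth hf) (differentiable_of_smooth hg),
    partialDeriv_add (differentiable_of_smooth (contDiff_partialDeriv hf i))
      (differentiable_of_smooth (contDiff_partialDeriv hg i))]

theorem lap_const_mul (hf : ContDiff ℝ ∞ f) (c : ℝ) :
    lap (fun x => c * f x) = fun x => c * lap f x := by
  funext x
  simp only [lap_eq_sum_partialDeriv, Finset.mul_sum]
  refine Finset.sum_congr rfl fun i _ => ?_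
  rw [partialDeriv_const_mul (differentiable_of_smooth hf),
    partialDeriv_const_mul (differentiable_of_smooth (contDiff_partialDeriv hf i))]

theorem partialDeriv_euler (hf : ContDiff ℝ ∞ f) (i : Fin n) :
    partialDeriv i (euler f) = fun x => euler (partialDeriv i f) x + partialDeriv i f x := by
  funext x
  have hd : DifferentiableAt ℝ (fderiv ℝ f) x :=
    (hf.fderiv_right (m := ∞) (by simp)).differentiable (by simp) x
  have hsymm : IsSymmSndFDerivAt ℝ f x :=
    (contDiff_infty.1 hf 2).contDiffAt.isSymmSndFDerivAt (by simp)
  unfold partialDeriv euler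
  rw [fderiv_clm_apply hd differentiableAt_fun_id,
    fderiv_clm_apply hd (differentiableAt_const _)]
  simp [hsymm.eq x (EuclideanSpace.single i 1), add_comm]

theorem lap_euler (hf : ContDiff ℝ ∞ f) :
    lap (euler f) = fun x => euler (lap f) x + 2 * lap f x := by
  funext x
  have h1 (i : Fin n) := contDiff_partialDeriv hf i
  have h2 (i : Fin n) := contDiff_partialDeriv (h1 i) i
  have h3 : lap f = fun x => ∑ i, partialDeriv i (partialDeriv i f) x := rfl
  rw [h3, euler_sum _ _ fun i _ => differentiable_of_smooth (h2 i), lap_eq_sum_partialDeriv,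
    Finset.mul_sum, ← Finset.sum_add_distrib]
  refine Finset.sum_congr rfl fun i _ => ?_
  rw [partialDeriv_euler hf, partialDeriv_add (differentiable_of_smooth (contDiff_euler (h1 i)))
    (differentiable_of_smooth (h1 i)), partialDeriv_euler (h1 i)]
  ring

theorem contDiff_normSq : ContDiff ℝ ∞ fun x : EuclideanSpace ℝ (Fin n) => ‖x‖ ^ 2 :=
  contDiff_norm_sq ℝ

theorem partialDeriv_normSq (i : Fin n) :
    partialDeriv i (fun x : EuclideanSpace ℝ (Fin n) => ‖x‖ ^ 2) = fun x => 2 * x i := by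
  funext x
  have := (hasStrictFDerivAt_norm_sq x).hasFDerivAt.fderiv
  simp [partialDeriv, this, two_mul, EuclideanSpace.inner_single_right]

theorem partialDeriv_coord (i : Fin n) :
    partialDeriv i (fun x : EuclideanSpace ℝ (Fin n) => x i) = fun _ => 1 := by
  funext x
  have : HasFDerivAt (fun x : EuclideanSpace ℝ (Fin n) => x i)
    (EuclideanSpace.proj (𝕜 := ℝ) i) x := (EuclideanSpace.proj (𝕜 := ℝ) i).hasFDerivAt
  simp [partialDeriv, this.fderiv]

theorem euler_normSq :
    euler (fun x : EuclideanSpace ℝ (Fin n) => ‖x‖ ^ 2) = fun x => 2 * ‖x‖ ^ 2 := by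
  funext x
  have := (hasStrictFDerivAt_norm_sq x).hasFDerivAt.fderiv
  simp [euler, this, two_mul]

theorem lap_normSq :
    lap (fun x : EuclideanSpace ℝ (Fin n) => ‖x‖ ^ 2) = fun _ => 2 * (n : ℝ) := by
  funext x
  have hc (i : Fin n) : Differentiable ℝ fun x : EuclideanSpace ℝ (Fin n) => x i := by fun_prop
  simp [lap_eq_sum_partialDeriv, partialDeriv_normSq, partialDeriv_const_mul (hc _),
    partialDeriv_coord, mul_comm]

theorem lap_normSq_mul (hf : ContDiff ℝ ∞ f) :
    lap (fun x => ‖x‖ ^ 2 * f x) =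
      fun x => 2 * (n : ℝ) * f x + 4 * euler f x + ‖x‖ ^ 2 * lap f x := by
  funext x
  have hN := differentiable_of_smooth (contDiff_normSq (n := n))
  have h1 (i : Fin n) := contDiff_partialDeriv hf i
  have hc (i : Fin n) : Differentiable ℝ fun x : EuclideanSpace ℝ (Fin n) => x i := by fun_prop
  have key (i : Fin n) : partialDeriv i (partialDeriv i fun x => ‖x‖ ^ 2 * f x) x =
      2 * f x + 4 * (x i * partialDeriv i f x) + ‖x‖ ^ 2 * partialDeriv i (partialDeriv i f) x := by
    rw [partialDeriv_mul hN (differentiable_of_smooth hf), partialDeriv_normSq,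
      partialDeriv_add (f := fun x => ‖x‖ ^ 2 * partialDeriv i f x)
        (g := fun x => 2 * x i * f x) (hN.mul (differentiable_of_smooth (h1 i)))
        (((hc i).const_mul 2).mul (differentiable_of_smooth hf)),
      partialDeriv_mul hN (differentiable_of_smooth (h1 i)), partialDeriv_normSq,
      partialDeriv_mul ((hc i).const_mul 2) (differentiable_of_smooth hf),
      partialDeriv_const_mul (hc i), partialDeriv_coord]
    ring
  rw [lap_eq_sum_partialDeriv, Finset.sum_congr rfl fun i _ => key i, Finset.sum_add_distrib,
    Finset.sum_add_distrib, ← Finset.mul_sum, ← Finset.mul_sum, ← Finset.mul_sum,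
    ← euler_eq_sum_partialDeriv,
    ← lap_eq_sum_partialDeriv]
  simp
  ring

end Operators

section Locality

variable {n : ℕ} {f g : EuclideanSpace ℝ (Fin n) → ℝ} {x : EuclideanSpace ℝ (Fin n)}

open Filter Topology

theorem eventuallyEq_partialDeriv (h : f =ᶠ[𝓝 x] g) (i : Fin n) :
    partialDeriv i f =ᶠ[𝓝 x] partialDeriv i g :=
  (h.fderiv (𝕜 := ℝ)).mono fun y hy => by simp only [partialDeriv, hy]

theorem eventuallyEq_lap (h : f =ᶠ[𝓝 x] g) : lap f =ᶠ[𝓝 x] lap g := by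
  have := eventually_all.2 fun i : Fin n =>
    eventuallyEq_partialDeriv (eventuallyEq_partialDeriv h i) i
  exact this.mono fun y hy => Finset.sum_congr rfl fun i _ => hy i

theorem eventuallyEq_euler (h : f =ᶠ[𝓝 x] g) : euler f =ᶠ[𝓝 x] euler g :=
  (h.fderiv (𝕜 := ℝ)).mono fun y hy => by simp only [euler, hy]

theorem eqOn_closedBall_of_eqOn_ball (hf : Continuous f) (hg : Continuous g)
    (h : Set.EqOn f g (Metric.ball 0 1)) : Set.EqOn f g (Metric.closedBall 0 1) := by
  rw [← closure_ball (0 : EuclideanSpace ℝ (Fin n)) one_ne_zero]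
  exact h.closure hf hg

theorem eqOn_euler_closedBall (hf : ContDiff ℝ ∞ f) (hg : ContDiff ℝ ∞ g)
    (h : Set.EqOn f g (Metric.closedBall 0 1)) :
    Set.EqOn (euler f) (euler g) (Metric.closedBall 0 1) := by
  refine eqOn_closedBall_of_eqOn_ball (contDiff_euler hf).continuous
    (contDiff_euler hg).continuous fun y hy => ?_
  have : f =ᶠ[𝓝 y] g := by
    filter_upwards [Metric.isOpen_ball.mem_nhds hy] with z hz
    exact h (Metric.ball_subset_closedBall hz)
  exact (eventuallyEq_euler this).eq_of_nhds

end Locality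

section MaximumPrinciple

variable {n : ℕ} {h : EuclideanSpace ℝ (Fin n) → ℝ}

open Filter Topology

theorem deriv_deriv_nonpos_of_isLocalMax {φ : ℝ → ℝ} {a : ℝ} (hc : ContinuousAt φ a)
    (hmax : IsLocalMax φ a) : deriv (deriv φ) a ≤ 0 := by
  by_contra! hpos
  have hmin := isLocalMin_of_deriv_deriv_pos hpos hmax.deriv_eq_zero hc
  have hconst : φ =ᶠ[𝓝 a] fun _ => φ a := by
    filter_upwards [hmax, hmin] with y h1 h2 using le_antisymm h1 h2
  have h0 : deriv (deriv φ) a = 0 := by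
    rw [hconst.deriv.deriv_eq]
    simp
  exact hpos.ne' h0

theorem deriv_comp_add_smul_single {f : EuclideanSpace ℝ (Fin n) → ℝ} (hf : Differentiable ℝ f)
    (z : EuclideanSpace ℝ (Fin n)) (i : Fin n) :
    (deriv fun t : ℝ => f (z + t • EuclideanSpace.single i 1)) =
      fun t => partialDeriv i f (z + t • EuclideanSpace.single i 1) := by
  funext t
  have h1 : HasDerivAt (fun t : ℝ => z + t • EuclideanSpace.single i (1 : ℝ))
      (EuclideanSpace.single i 1) t := by
    simpa using ((hasDerivAt_id t).smul_const (EuclideanSpace.single i (1 : ℝ))).const_add z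
  exact ((hf _).hasFDerivAt.comp_hasDerivAt t h1).deriv

theorem lap_nonpos_of_isLocalMax (hh : ContDiff ℝ ∞ h) {z : EuclideanSpace ℝ (Fin n)}
    (hz : IsLocalMax h z) : lap h z ≤ 0 := by
  refine Finset.sum_nonpos fun i _ => ?_
  have hcont : Continuous fun t : ℝ => z + t • EuclideanSpace.single i (1 : ℝ) := by fun_prop
  have hmax : IsLocalMax (fun t : ℝ => h (z + t • EuclideanSpace.single i (1 : ℝ))) 0 := by
    have h0 : Tendsto (fun t : ℝ => z + t • EuclideanSpace.single i (1 : ℝ)) (𝓝 0) (𝓝 z) := by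
      simpa using hcont.tendsto 0
    simpa [IsLocalMax, IsMaxFilter] using h0.eventually hz
  have : deriv (deriv fun t : ℝ => h (z + t • EuclideanSpace.single i (1 : ℝ))) 0 ≤ 0 :=
    deriv_deriv_nonpos_of_isLocalMax (hh.continuous.comp hcont).continuousAt hmax
  rw [deriv_comp_add_smul_single (differentiable_of_smooth hh), deriv_comp_add_smul_single
    (differentiable_of_smooth (contDiff_partialDeriv hh i))] at this
  simp only [zero_smul, add_zero] at this
  exact this

theorem nonpos_of_lap_eq_zero (hn : n ≠ 0) (hh : ContDiff ℝ ∞ h)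
    (hlap : ∀ x ∈ Metric.ball (0 : EuclideanSpace ℝ (Fin n)) 1, lap h x = 0)
    (hbd : ∀ y : EuclideanSpace ℝ (Fin n), ‖y‖ = 1 → h y = 0)
    {x : EuclideanSpace ℝ (Fin n)} (hx : x ∈ Metric.closedBall 0 1) : h x ≤ 0 := by
  by_contra! hpos
  set ε := h x / 2 with hε
  have hv : ContDiff ℝ ∞ fun y : EuclideanSpace ℝ (Fin n) => h y + ε * ‖y‖ ^ 2 :=
    hh.add (contDiff_const.mul contDiff_normSq)
  obtain ⟨z, hz, hzmax⟩ := (isCompact_closedBall (0 : EuclideanSpace ℝ (Fin n)) 1).exists_isMaxOn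
    ⟨x, hx⟩ hv.continuous.continuousOn
  have hxz : h x + ε * ‖x‖ ^ 2 ≤ h z + ε * ‖z‖ ^ 2 := hzmax hx
  have hzball : z ∈ Metric.ball (0 : EuclideanSpace ℝ (Fin n)) 1 := by
    rw [mem_closedBall_zero_iff] at hz
    rw [mem_ball_zero_iff]
    refine hz.lt_of_ne fun h1 => ?_
    rw [hbd z h1, h1] at hxz
    nlinarith [sq_nonneg ‖x‖]
  have hloc := hzmax.isLocalMax (mem_of_superset (Metric.isOpen_ball.mem_nhds hzball)
    Metric.ball_subset_closedBall)
  have hle := lap_nonpos_of_isLocalMax hv hloc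
  rw [lap_add hh (contDiff_const.mul contDiff_normSq), lap_const_mul contDiff_normSq,
    lap_normSq] at hle
  simp only [hlap z hzball] at hle
  have : 0 < (n : ℝ) := by positivity
  nlinarith [mul_pos hpos this]

theorem eq_zero_of_lap_eq_zero (hn : n ≠ 0) (hh : ContDiff ℝ ∞ h)
    (hlap : ∀ x ∈ Metric.ball (0 : EuclideanSpace ℝ (Fin n)) 1, lap h x = 0)
    (hbd : ∀ y : EuclideanSpace ℝ (Fin n), ‖y‖ = 1 → h y = 0)
    {x : EuclideanSpace ℝ (Fin n)} (hx : x ∈ Metric.closedBall 0 1) : h x = 0 := by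
  refine le_antisymm (nonpos_of_lap_eq_zero hn hh hlap hbd hx) ?_
  have := nonpos_of_lap_eq_zero (h := fun y => -1 * h y) hn (contDiff_const.mul hh)
    (fun y hy => (congrFun (lap_const_mul hh (-1)) y).trans (by rw [hlap y hy, mul_zero]))
    (fun y hy => by rw [hbd y hy, mul_zero]) hx
  linarith

end MaximumPrinciple

section RadialIntegral

open MeasureTheory

/-- The weighted mean `∫₀¹ sᵐ f(s²x) ds` along the segment from `0` to `x`. -/
noncomputable def radialIntegral {E F : Type} [NormedAddCommGroup E] [NormedSpace ℝ E]
    [NormedAddCommGroup F] [NormedSpace ℝ F] (m : ℕ) (f : E → F) (x : E) : F :=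
  ∫ s in (0 : ℝ)..1, s ^ m • f (s ^ 2 • x)

variable {E F : Type} [NormedAddCommGroup E] [NormedSpace ℝ E] [ProperSpace E]
  [NormedAddCommGroup F] [NormedSpace ℝ F]

theorem hasFDerivAt_radialIntegral (m : ℕ) {f : E → F} (hf : ContDiff ℝ 1 f) (x : E) :
    HasFDerivAt (radialIntegral m f) (radialIntegral (m + 2) (fderiv ℝ f) x) x := by
  have hf' : Continuous (fderiv ℝ f) := hf.continuous_fderiv one_ne_zero
  have hfc := hf.continuous
  have hcont : Continuous fun p : ℝ × E => p.1 ^ (m + 2) • fderiv ℝ f (p.1 ^ 2 • p.2) := by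
    fun_prop
  obtain ⟨C, hC⟩ := ((isCompact_Icc (a := (0 : ℝ)) (b := 1)).prod
    (isCompact_closedBall x 1)).exists_bound_of_continuousOn hcont.continuousOn
  have : SecondCountableTopologyEither ℝ (E →L[ℝ] F) := secondCountableTopologyEither_of_left _ _
  refine intervalIntegral.hasFDerivAt_integral_of_dominated_of_fderiv_le
    (F := fun y s => s ^ m • f (s ^ 2 • y))
    (F' := fun y s => s ^ (m + 2) • fderiv ℝ f (s ^ 2 • y)) (bound := fun _ => C)
    (Metric.closedBall_mem_nhds x one_pos) ?_ ?_ ?_ ?_ ?_ ?_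
  · refine .of_forall fun y => Continuous.aestronglyMeasurable ?_
    fun_prop
  · refine Continuous.intervalIntegrable ?_ _ _
    fun_prop
  · refine Continuous.aestronglyMeasurable ?_
    fun_prop
  · refine .of_forall fun s hs y hy => hC (s, y) ⟨?_, hy⟩
    rw [Set.uIoc_of_le zero_le_one] at hs
    exact ⟨hs.1.le, hs.2⟩
  · exact intervalIntegrable_const
  · refine .of_forall fun s _ y _ => ?_
    have h1 : HasFDerivAt (fun y : E => s ^ 2 • y) (s ^ 2 • ContinuousLinearMap.id ℝ E) y :=
      (hasFDerivAt_id y).const_smul (s ^ 2)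
    have h2 := (((hf.differentiable one_ne_zero) _).hasFDerivAt.comp y h1).const_smul (s ^ m)
    convert! h2 using 1
    ext v
    simp [smul_smul, pow_add]

theorem contDiff_radialIntegral (m : ℕ) {f : E → F} (hf : ContDiff ℝ ∞ f) :
    ContDiff ℝ ∞ (radialIntegral m f) := by
  rw [contDiff_infty]
  intro k
  induction k generalizing F m with
  | zero =>
    exact contDiff_zero.2 (continuous_iff_continuousAt.2 fun x =>
      (hasFDerivAt_radialIntegral m (contDiff_infty.1 hf 1) x).continuousAt)
  | succ k ih =>
    have hd : fderiv ℝ (radialIntegral m f) = radialIntegral (m + 2) (fderiv ℝ f) :=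
      funext fun x => (hasFDerivAt_radialIntegral m (contDiff_infty.1 hf 1) x).fderiv
    refine (contDiff_succ_iff_fderiv (n := k)).2 ⟨fun x =>
      (hasFDerivAt_radialIntegral m (contDiff_infty.1 hf 1) x).differentiableAt, by simp, ?_⟩
    rw [hd]
    exact ih (m + 2) (hf.fderiv_right (m := ∞) (by simp))

theorem fderiv_radialIntegral_apply (m : ℕ) {f : E → ℝ} (hf : ContDiff ℝ ∞ f) (x v : E) :
    fderiv ℝ (radialIntegral m f) x v = radialIntegral (m + 2) (fun y => fderiv ℝ f y v) x := by
  have hf' : Continuous (fderiv ℝ f) := hf.continuous_fderiv (by simp)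
  rw [(hasFDerivAt_radialIntegral m (contDiff_infty.1 hf 1) x).fderiv, radialIntegral,
    ContinuousLinearMap.intervalIntegral_apply]
  · rfl
  · refine Continuous.intervalIntegrable ?_ _ _
    fun_prop

variable {n : ℕ} {f : EuclideanSpace ℝ (Fin n) → ℝ}

theorem lap_radialIntegral (m : ℕ) (hf : ContDiff ℝ ∞ f) (x : EuclideanSpace ℝ (Fin n)) :
    lap (radialIntegral m f) x = radialIntegral (m + 4) (lap f) x := by
  have h1 (k : ℕ) (i : Fin n) {g : EuclideanSpace ℝ (Fin n) → ℝ} (hg : ContDiff ℝ ∞ g) :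
      partialDeriv i (radialIntegral k g) = radialIntegral (k + 2) (partialDeriv i g) :=
    funext fun y => fderiv_radialIntegral_apply k hg y _
  have h2 : radialIntegral (m + 4) (lap f) x =
      ∑ i, radialIntegral (m + 4) (partialDeriv i (partialDeriv i f)) x := by
    simp only [radialIntegral, lap_eq_sum_partialDeriv, Finset.smul_sum]
    refine intervalIntegral.integral_finsetSum fun i _ => Continuous.intervalIntegrable ?_ _ _
    have := (contDiff_partialDeriv (contDiff_partialDeriv hf i) i).continuous
    fun_prop
  rw [h2, lap_eq_sum_partialDeriv]
  refine Finset.sum_congr rfl fun i _ => ?_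
  rw [h1 m i hf, h1 (m + 2) i (contDiff_partialDeriv hf i)]

theorem radialIntegral_eq_zero (m : ℕ) (hf : Set.EqOn f 0 (Metric.closedBall 0 1)) :
    Set.EqOn (radialIntegral m f) 0 (Metric.closedBall 0 1) := by
  intro x hx
  rw [mem_closedBall_zero_iff] at hx
  refine intervalIntegral.integral_zero_ae (.of_forall fun s hs => ?_)
  rw [Set.uIoc_of_le zero_le_one] at hs
  have : s ^ 2 • x ∈ Metric.closedBall (0 : EuclideanSpace ℝ (Fin n)) 1 := by
    rw [mem_closedBall_zero_iff, norm_smul, Real.norm_of_nonneg (by positivity)]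
    exact mul_le_one₀ (pow_le_one₀ hs.1.le hs.2) (norm_nonneg _) hx
  simp [hf this]

theorem radialIntegral_euler (m : ℕ) (hf : ContDiff ℝ ∞ f) (x : EuclideanSpace ℝ (Fin n)) :
    (m + 1) * radialIntegral m f x + 2 * euler (radialIntegral m f) x = f x := by
  have hfc := hf.continuous
  have hf' : Continuous (fderiv ℝ f) := hf.continuous_fderiv (by simp)
  have hderiv (s : ℝ) : HasDerivAt (fun s : ℝ => s ^ (m + 1) * f (s ^ 2 • x))
      ((m + 1) * (s ^ m • f (s ^ 2 • x)) + 2 * (s ^ (m + 2) • fderiv ℝ f (s ^ 2 • x) x)) s := by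
    have h1 : HasDerivAt (fun s : ℝ => s ^ 2 • x) ((2 * s) • x) s := by
      simpa using (hasDerivAt_pow 2 s).smul_const x
    have h2 := (differentiable_of_smooth hf (s ^ 2 • x)).hasFDerivAt.comp_hasDerivAt s h1
    convert! (hasDerivAt_pow (m + 1) s).mul h2 using 1
    simp only [map_smul, smul_eq_mul, Function.comp_apply]
    rw [Nat.add_sub_cancel]
    push_cast
    ring
  have hint1 : IntervalIntegrable (fun s : ℝ => (m + 1) * (s ^ m • f (s ^ 2 • x)))
      volume 0 1 := by
    refine Continuous.intervalIntegrable ?_ _ _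
    fun_prop
  have hint2 : IntervalIntegrable (fun s : ℝ => 2 * (s ^ (m + 2) • fderiv ℝ f (s ^ 2 • x) x))
      volume 0 1 := by
    refine Continuous.intervalIntegrable ?_ _ _
    fun_prop
  have := intervalIntegral.integral_eq_sub_of_hasDerivAt (fun s _ => hderiv s) (hint1.add hint2)
  rw [intervalIntegral.integral_add hint1 hint2, intervalIntegral.integral_const_mul,
    intervalIntegral.integral_const_mul] at this
  rw [euler, fderiv_radialIntegral_apply m hf]
  simpa [radialIntegral] using this

end RadialIntegral

section EulerOperatorOnLine

open Filter Topology

/-- The Euler operator `f ↦ r df/dr` on the real line. -/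
noncomputable def lineEuler (f : ℝ → ℝ) (r : ℝ) : ℝ := r * deriv f r

variable {f g : ℝ → ℝ}

theorem contDiff_deriv_of_smooth (hf : ContDiff ℝ ∞ f) : ContDiff ℝ ∞ (deriv f) :=
  (contDiff_infty_iff_deriv.1 hf).2

theorem contDiff_lineEuler (hf : ContDiff ℝ ∞ f) : ContDiff ℝ ∞ (lineEuler f) :=
  contDiff_id.mul (contDiff_deriv_of_smooth hf)

theorem differentiable_iteratedDeriv_of_smooth (hf : ContDiff ℝ ∞ f) (j : ℕ) :
    Differentiable ℝ (iteratedDeriv j f) :=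
  hf.differentiable_iteratedDeriv j (by exact_mod_cast ENat.natCast_lt_top j)

theorem iteratedDeriv_lineEuler (hf : ContDiff ℝ ∞ f) (j : ℕ) :
    iteratedDeriv j (lineEuler f) =
      fun r => r * iteratedDeriv (j + 1) f r + j * iteratedDeriv j f r := by
  induction j with
  | zero => funext r; simp [lineEuler]
  | succ j ih =>
    funext r
    have h1 := (differentiable_iteratedDeriv_of_smooth hf (j + 1) r).hasDerivAt
    have h0 := (differentiable_iteratedDeriv_of_smooth hf j r).hasDerivAt
    have h2 : HasDerivAt (fun r => r * iteratedDeriv (j + 1) f r + j * iteratedDeriv j f r) _ r :=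
      ((hasDerivAt_id r).mul h1).add (h0.const_mul (j : ℝ))
    rw [iteratedDeriv_succ, ih, h2.deriv, ← iteratedDeriv_succ, ← iteratedDeriv_succ]
    push_cast
    simp only [id]
    ring

theorem iteratedDeriv_lineEuler_zero (hf : ContDiff ℝ ∞ f) (j : ℕ) :
    iteratedDeriv j (lineEuler f) 0 = j * iteratedDeriv j f 0 := by
  simp [iteratedDeriv_lineEuler hf]

theorem abs_le_mul_pow_of_iteratedDeriv_eq_zero (hf : ContDiff ℝ ∞ f)
    (hflat : ∀ j, iteratedDeriv j f 0 = 0) (N : ℕ) :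
    ∃ C, 0 ≤ C ∧ ∀ r ∈ Set.Icc (0 : ℝ) 1, |f r| ≤ C * r ^ N := by
  induction N generalizing f with
  | zero =>
    obtain ⟨C, hC⟩ := (isCompact_Icc (a := (0 : ℝ)) (b := 1)).exists_bound_of_continuousOn
      hf.continuous.continuousOn
    exact ⟨C, (norm_nonneg _).trans (hC 0 (by simp)), fun r hr => by simpa using hC r hr⟩
  | succ N ih =>
    obtain ⟨C, hC0, hC⟩ := ih (contDiff_deriv_of_smooth hf) fun j => by
      rw [← iteratedDeriv_succ', hflat]
    refine ⟨C, hC0, fun r hr => ?_⟩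
    have h := (convex_Icc (0 : ℝ) r).norm_image_sub_le_of_norm_deriv_le (f := f)
      (C := C * r ^ N) (x := 0) (y := r) (fun x _ => hf.differentiable (by simp) x)
      (fun x hx => (hC x ⟨hx.1, hx.2.trans hr.2⟩).trans (by
        have := hx.1
        have := hx.2
        gcongr)) ⟨le_rfl, hr.1⟩ ⟨hr.1, le_rfl⟩
    have h0 : f 0 = 0 := by simpa using hflat 0
    rw [h0, sub_zero, sub_zero, Real.norm_eq_abs, Real.norm_of_nonneg hr.1] at h
    rwa [pow_succ, ← mul_assoc]

/-- A nonnegative function vanishing to order more than `m` at `0` and satisfying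
`r y'(r) ≤ m y(r)` vanishes identically. -/
theorem eq_zero_of_lineEuler_le {y : ℝ → ℝ} (m : ℕ) (hy : Differentiable ℝ y)
    (hnonneg : ∀ r, 0 ≤ y r) (hle : ∀ r ∈ Set.Icc (0 : ℝ) 1, lineEuler y r ≤ m * y r)
    {C : ℝ} (hC : ∀ r ∈ Set.Icc (0 : ℝ) 1, y r ≤ C * r ^ (m + 1))
    {r : ℝ} (hr : r ∈ Set.Icc (0 : ℝ) 1) : y r = 0 := by
  refine le_antisymm ?_ (hnonneg r)
  rcases hr.1.eq_or_lt with rfl | hr0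
  · simpa using hC 0 (by simp)
  have hderiv : ∀ s ∈ Set.Ioc (0 : ℝ) 1, HasDerivAt (fun s => y s / s ^ m)
      ((deriv y s * s ^ m - y s * (m * s ^ (m - 1))) / (s ^ m) ^ 2) s := fun s hs =>
    (hy s).hasDerivAt.div (hasDerivAt_pow m s) (pow_pos hs.1 m).ne'
  have hanti : AntitoneOn (fun s => y s / s ^ m) (Set.Ioc 0 1) := by
    refine antitoneOn_of_deriv_nonpos (convex_Ioc 0 1)
      (fun s hs => (hderiv s hs).continuousAt.continuousWithinAt)
      (fun s hs => (hderiv s (interior_subset hs)).differentiableAt.differentiableWithinAt)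
      fun s hs => ?_
    have hs' := interior_subset hs
    rw [(hderiv s hs').deriv]
    refine div_nonpos_of_nonpos_of_nonneg ?_ (by positivity)
    have h1 := hle s ⟨hs'.1.le, hs'.2⟩
    unfold lineEuler at h1
    rcases m with _ | m
    · have := hs'.1
      simp only [Nat.cast_zero, zero_mul] at h1
      simp only [pow_zero, mul_one, Nat.cast_zero, zero_mul, mul_zero, sub_zero]
      by_contra! h2
      exact absurd h1 (mul_pos this h2).not_ge
    · rw [Nat.add_sub_cancel, pow_succ]
      have := mul_le_mul_of_nonneg_left h1 (pow_pos hs'.1 m).le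
      linarith
  have hbound : ∀ s ∈ Set.Ioc (0 : ℝ) r, y r / r ^ m ≤ C * s := by
    intro s hs
    have hs1 : s ∈ Set.Ioc (0 : ℝ) 1 := ⟨hs.1, hs.2.trans hr.2⟩
    refine (hanti hs1 ⟨hr0, hr.2⟩ hs.2).trans ?_
    have := hC s ⟨hs1.1.le, hs1.2⟩
    rw [div_le_iff₀ (pow_pos hs.1 m)]
    rwa [mul_assoc, ← pow_succ']
  have hlim : Tendsto (fun s : ℝ => C * s) (𝓝[>] 0) (𝓝 0) := by
    have h : Continuous fun s : ℝ => C * s := by fun_prop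
    simpa using (h.tendsto 0).mono_left nhdsWithin_le_nhds
  have hq : y r / r ^ m ≤ 0 :=
    ge_of_tendsto hlim (mem_of_superset (Ioc_mem_nhdsGT hr0) hbound)
  have := (div_le_iff₀ (pow_pos hr0 m)).1 hq
  simpa using this

theorem lineEuler_sq (hf : Differentiable ℝ f) :
    lineEuler (fun r => f r ^ 2) = fun r => 2 * f r * lineEuler f r := by
  funext r
  have h : HasDerivAt (fun r => f r ^ 2) _ r := (hf r).hasDerivAt.pow 2
  rw [lineEuler, h.deriv, lineEuler]
  simp
  ring

theorem lineEuler_add (hf : Differentiable ℝ f) (hg : Differentiable ℝ g) :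
    lineEuler (fun r => f r + g r) = fun r => lineEuler f r + lineEuler g r := by
  funext r
  simp [lineEuler, deriv_fun_add (hf r) (hg r), mul_add]

theorem lineEuler_const_mul_pow (c : ℝ) (k : ℕ) :
    lineEuler (fun r => c * r ^ k) = fun r => c * k * r ^ k := by
  funext r
  rw [lineEuler, ((hasDerivAt_pow k r).const_mul c).deriv]
  rcases k with _ | k
  · simp
  · rw [Nat.add_sub_cancel]
    ring

/-- A flat smooth solution of a third order Euler differential equation vanishes. -/
theorem eq_zero_of_iteratedDeriv_eq_zero (hf : ContDiff ℝ ∞ f)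
    (hflat : ∀ j, iteratedDeriv j f 0 = 0) (a b c : ℝ)
    (hode : ∀ r ∈ Set.Icc (0 : ℝ) 1, lineEuler (lineEuler (lineEuler f)) r =
      a * lineEuler (lineEuler f) r + b * lineEuler f r + c * f r)
    {r : ℝ} (hr : r ∈ Set.Icc (0 : ℝ) 1) : f r = 0 := by
  have hf1 := contDiff_lineEuler hf
  have hf2 := contDiff_lineEuler hf1
  have hd0 : Differentiable ℝ f := hf.differentiable (by simp)
  have hd1 : Differentiable ℝ (lineEuler f) := hf1.differentiable (by simp)
  have hd2 : Differentiable ℝ (lineEuler (lineEuler f)) := hf2.differentiable (by simp)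
  have hflat1 : ∀ j, iteratedDeriv j (lineEuler f) 0 = 0 := fun j => by
    rw [iteratedDeriv_lineEuler_zero hf, hflat, mul_zero]
  have hflat2 : ∀ j, iteratedDeriv j (lineEuler (lineEuler f)) 0 = 0 := fun j => by
    rw [iteratedDeriv_lineEuler_zero hf1, hflat1, mul_zero]
  obtain ⟨m, hm⟩ := exists_nat_ge (2 * (2 + |a| + |b| + |c|))
  obtain ⟨C0, -, hb0⟩ := abs_le_mul_pow_of_iteratedDeriv_eq_zero hf hflat (m + 1)
  obtain ⟨C1, -, hb1⟩ := abs_le_mul_pow_of_iteratedDeriv_eq_zero hf1 hflat1 (m + 1)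
  obtain ⟨C2, -, hb2⟩ := abs_le_mul_pow_of_iteratedDeriv_eq_zero hf2 hflat2 (m + 1)
  have hsq {C z s : ℝ} (hs : s ∈ Set.Icc (0 : ℝ) 1) (h : |z| ≤ C * s ^ (m + 1)) :
      z ^ 2 ≤ C ^ 2 * s ^ (m + 1) := by
    have h1 : z ^ 2 ≤ (C * s ^ (m + 1)) ^ 2 := by
      rw [← sq_abs z]
      exact pow_le_pow_left₀ (abs_nonneg z) h 2
    have h2 : s ^ (m + 1) ≤ 1 := pow_le_one₀ hs.1 hs.2
    have h3 : 0 ≤ s ^ (m + 1) := pow_nonneg hs.1 _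
    nlinarith [mul_le_mul_of_nonneg_left h2 (mul_nonneg (sq_nonneg C) h3)]
  have hy := eq_zero_of_lineEuler_le
    (y := fun s => f s ^ 2 + lineEuler f s ^ 2 + lineEuler (lineEuler f) s ^ 2) m
    (((hd0.pow 2).add (hd1.pow 2)).add (hd2.pow 2)) (fun s => by positivity) ?_
    (C := C0 ^ 2 + C1 ^ 2 + C2 ^ 2)
    (fun s hs => by
      have h0 := hsq hs (hb0 s hs)
      have h1 := hsq hs (hb1 s hs)
      have h2 := hsq hs (hb2 s hs)
      linarith) hr
  · have h1 := sq_nonneg (lineEuler f r)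
    have h2 := sq_nonneg (lineEuler (lineEuler f) r)
    have h0 := sq_nonneg (f r)
    exact pow_eq_zero_iff two_ne_zero |>.1 (by linarith)
  · intro s hs
    rw [lineEuler_add (f := fun s => f s ^ 2 + lineEuler f s ^ 2)
      (g := fun s => lineEuler (lineEuler f) s ^ 2) ((hd0.pow 2).add (hd1.pow 2)) (hd2.pow 2),
      lineEuler_add (f := fun s => f s ^ 2) (g := fun s => lineEuler f s ^ 2) (hd0.pow 2)
        (hd1.pow 2), lineEuler_sq hd0, lineEuler_sq hd1,
      lineEuler_sq hd2]
    simp only [hode s hs]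
    generalize lineEuler (lineEuler f) s = z
    generalize lineEuler f s = y
    generalize f s = x
    have hcross (p q t : ℝ) : 2 * p * (t * q) ≤ |t| * (p ^ 2 + q ^ 2) := by
      rw [← sq_abs p, ← sq_abs q]
      have h1 : 2 * p * (t * q) ≤ |2 * p * (t * q)| := le_abs_self _
      have h2 : |2 * p * (t * q)| = |t| * (2 * |p| * |q|) := by
        rw [abs_mul, abs_mul, abs_mul, abs_two]
        ring
      nlinarith [mul_nonneg (abs_nonneg t) (sq_nonneg (|p| - |q|))]
    have hS : 0 ≤ x ^ 2 + y ^ 2 + z ^ 2 := by positivity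
    have hmS := mul_le_mul_of_nonneg_right hm hS
    have ha := abs_nonneg a
    have hb := abs_nonneg b
    have hc := abs_nonneg c
    have e1 := hcross x y 1
    have e2 := hcross y z 1
    have e3 := hcross z z a
    have e4 := hcross z y b
    have e5 := hcross z x c
    rw [abs_one] at e1 e2
    nlinarith [mul_nonneg ha (sq_nonneg x), mul_nonneg ha (sq_nonneg y),
      mul_nonneg hb (sq_nonneg x),
      mul_nonneg hb (sq_nonneg y), mul_nonneg hb (sq_nonneg z), mul_nonneg hc (sq_nonneg x),
      mul_nonneg hc (sq_nonneg y), mul_nonneg hc (sq_nonneg z), sq_nonneg x, sq_nonneg y,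
      sq_nonneg z]

/-- If `A θ³f + B θ²f + C θf = σ f` near `[0, 1]`, where `θ = r d/dr`, and `k` is the only
possible natural root of the indicial equation, then `f` is a multiple of `r ^ k`. -/
theorem eq_mul_pow_of_lineEuler (hf : ContDiff ℝ ∞ f) {A B C σ : ℝ} (hA : A ≠ 0)
    (hode : ∀ r ∈ Set.Icc (-1 : ℝ) 1, A * lineEuler (lineEuler (lineEuler f)) r +
      B * lineEuler (lineEuler f) r + C * lineEuler f r = σ * f r) (k : ℕ)
    (hk : ∀ j : ℕ, A * j ^ 3 + B * j ^ 2 + C * j = σ → j = k) :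
    (A * k ^ 3 + B * k ^ 2 + C * k - σ) * iteratedDeriv k f 0 = 0 ∧
      ∀ r ∈ Set.Icc (0 : ℝ) 1, f r = iteratedDeriv k f 0 / k.factorial * r ^ k := by
  have hf1 := contDiff_lineEuler hf
  have hf2 := contDiff_lineEuler hf1
  have hf3 := contDiff_lineEuler hf2
  have hcoeff (j : ℕ) : (A * j ^ 3 + B * j ^ 2 + C * j - σ) * iteratedDeriv j f 0 = 0 := by
    have hev : (fun r => A * lineEuler (lineEuler (lineEuler f)) r +
        B * lineEuler (lineEuler f) r + C * lineEuler f r) =ᶠ[𝓝 0] fun r => σ * f r := by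
      filter_upwards [Icc_mem_nhds (show (-1 : ℝ) < 0 by norm_num) zero_lt_one] with r hr
      exact hode r hr
    have hsm {g : ℝ → ℝ} (hg : ContDiff ℝ ∞ g) : ContDiffAt ℝ j g 0 :=
      (contDiff_infty.1 hg j).contDiffAt
    have := hev.iteratedDeriv_eq j
    rw [iteratedDeriv_fun_add (hsm ((contDiff_const.mul hf3).add (contDiff_const.mul hf2)))
      (hsm (contDiff_const.mul hf1)), iteratedDeriv_fun_add (hsm (contDiff_const.mul hf3))
      (hsm (contDiff_const.mul hf2))] at this
    simp only [iteratedDeriv_const_mul_field, iteratedDeriv_lineEuler_zero hf,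
      iteratedDeriv_lineEuler_zero hf1, iteratedDeriv_lineEuler_zero hf2] at this
    linear_combination this
  refine ⟨hcoeff k, fun r hr => ?_⟩
  set c := -(iteratedDeriv k f 0 / k.factorial) with hc
  have hpow (d : ℝ) : ContDiff ℝ ∞ fun r : ℝ => d * r ^ k := contDiff_const.mul (contDiff_id.pow k)
  have hd {g : ℝ → ℝ} (hg : ContDiff ℝ ∞ g) : Differentiable ℝ g := hg.differentiable (by simp)
  have hroot : (A * k ^ 3 + B * k ^ 2 + C * k - σ) * c = 0 := by
    rw [hc, mul_neg, ← mul_div_assoc, hcoeff k]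
    simp
  have hflat (j : ℕ) : iteratedDeriv j (fun r => f r + c * r ^ k) 0 = 0 := by
    rw [iteratedDeriv_fun_add ((contDiff_infty.1 hf j).contDiffAt)
      ((contDiff_infty.1 (hpow c) j).contDiffAt)]
    by_cases hjk : j = k
    · subst hjk
      have hfac : (j.factorial : ℝ) ≠ 0 := by positivity
      rw [iteratedDeriv_const_mul_field, iteratedDeriv_pow, Nat.descFactorial_self, hc]
      field_simp
      simp
    · have h1 : iteratedDeriv j f 0 = 0 :=
        (mul_eq_zero.1 (hcoeff j)).resolve_left fun h => hjk (hk j (sub_eq_zero.1 h))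
      have h2 : ((j : ℝ) - k) * iteratedDeriv j (fun r => c * r ^ k) 0 = 0 := by
        have h3 := iteratedDeriv_lineEuler_zero (hpow c) j
        have h4 : lineEuler (fun r => c * r ^ k) = fun r => (k : ℝ) * (c * r ^ k) := by
          rw [lineEuler_const_mul_pow]
          funext r
          ring
        rw [h4, iteratedDeriv_const_mul_field] at h3
        linear_combination -h3
      have h5 : (j : ℝ) - k ≠ 0 := sub_ne_zero.2 (by exact_mod_cast hjk)
      rw [h1, (mul_eq_zero.1 h2).resolve_left h5, add_zero]
  have h1 : lineEuler (fun r => f r + c * r ^ k) =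
      fun r => lineEuler f r + c * k * r ^ k := by
    rw [lineEuler_add (hd hf) (hd (hpow c)), lineEuler_const_mul_pow]
  have h2 : lineEuler (fun r => lineEuler f r + c * k * r ^ k) =
      fun r => lineEuler (lineEuler f) r + c * k * k * r ^ k := by
    rw [lineEuler_add (hd hf1) (hd (hpow _)), lineEuler_const_mul_pow]
  have h3 : lineEuler (fun r => lineEuler (lineEuler f) r + c * k * k * r ^ k) =
      fun r => lineEuler (lineEuler (lineEuler f)) r + c * k * k * k * r ^ k := by
    rw [lineEuler_add (hd hf2) (hd (hpow _)), lineEuler_const_mul_pow]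
  have hzero := eq_zero_of_iteratedDeriv_eq_zero (hf.add (hpow c)) hflat (-B / A) (-C / A) (σ / A)
    (fun s hs => by
      have := hode s ⟨by linarith [hs.1], hs.2⟩
      simp only [h1, h2, h3]
      field_simp
      linear_combination this + s ^ k * hroot) hr
  rw [hc] at hzero
  linear_combination hzero

end EulerOperatorOnLine

section Almansi

variable {n : ℕ} {f g u : EuclideanSpace ℝ (Fin n) → ℝ}

theorem lap_euler_eq_zero (hf : ContDiff ℝ ∞ f)
    (hlap : ∀ x ∈ Metric.ball 0 1, lap f x = 0) :
    ∀ x ∈ Metric.ball 0 1, lap (euler f) x = 0 := by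
  intro x hx
  have h : lap f =ᶠ[nhds x] fun _ => 0 :=
    Filter.eventually_of_mem (Metric.isOpen_ball.mem_nhds hx) hlap
  have he : euler (lap f) x = 0 := by
    rw [(eventuallyEq_euler h).self_of_nhds]
    simp [euler]
  rw [lap_euler hf]
  simp only [he, hlap x hx]
  ring

/-- Almansi decomposition of a biharmonic function on the unit ball. -/
theorem exists_almansi_decomposition (hn : n ≠ 0) (hu : ContDiff ℝ ∞ u)
    (hbih : ∀ x ∈ Metric.ball 0 1, lap (lap u) x = 0) :
    ∃ h₀ h₁ : EuclideanSpace ℝ (Fin n) → ℝ, ContDiff ℝ ∞ h₀ ∧ ContDiff ℝ ∞ h₁ ∧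
      (∀ x ∈ Metric.ball 0 1, lap h₀ x = 0) ∧ (∀ x ∈ Metric.ball 0 1, lap h₁ x = 0) ∧
      (u = fun x => h₀ x + (‖x‖ ^ 2 * h₁ x + -1 * h₁ x)) ∧
      lap u = fun x => 2 * n * h₁ x + 4 * euler h₁ x := by
  have hg := contDiff_lap hu
  have hR := contDiff_radialIntegral (n - 1) hg
  have hlapg : Set.EqOn (lap (lap u)) 0 (Metric.closedBall 0 1) :=
    eqOn_closedBall_of_eqOn_ball (contDiff_lap hg).continuous continuous_const hbih
  have hlapR (x : EuclideanSpace ℝ (Fin n)) (hx : x ∈ Metric.closedBall 0 1) :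
      lap (radialIntegral (n - 1) (lap u)) x = 0 := by
    rw [lap_radialIntegral _ hg]
    exact radialIntegral_eq_zero _ hlapg hx
  set h₁ : EuclideanSpace ℝ (Fin n) → ℝ :=
    fun x => 1 / 2 * radialIntegral (n - 1) (lap u) x with h₁_def
  have hh₁ : ContDiff ℝ ∞ h₁ := contDiff_const.mul hR
  have hlap₁ : ∀ x ∈ Metric.ball 0 1, lap h₁ x = 0 := fun x hx => by
    rw [h₁_def, lap_const_mul hR]
    simp only [hlapR x (Metric.ball_subset_closedBall hx), mul_zero]
  have hlapu : lap u = fun x => 2 * n * h₁ x + 4 * euler h₁ x := by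
    funext x
    have h := radialIntegral_euler (n - 1) hg x
    rw [Nat.cast_sub (Nat.one_le_iff_ne_zero.2 hn), Nat.cast_one] at h
    rw [h₁_def, euler_const_mul (differentiable_of_smooth hR), ← h]
    ring
  have hN₁ : ContDiff ℝ ∞ fun x : EuclideanSpace ℝ (Fin n) => ‖x‖ ^ 2 * h₁ x :=
    contDiff_normSq.mul hh₁
  have hq : ContDiff ℝ ∞ fun x : EuclideanSpace ℝ (Fin n) => h₁ x + -1 * (‖x‖ ^ 2 * h₁ x) :=
    hh₁.add (contDiff_const.mul hN₁)
  refine ⟨fun x => u x + (h₁ x + -1 * (‖x‖ ^ 2 * h₁ x)), h₁, hu.add hq, hh₁, ?_, hlap₁,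
    funext fun x => by ring, hlapu⟩
  intro x hx
  rw [lap_add hu hq, lap_add hh₁ (contDiff_const.mul hN₁), lap_const_mul hN₁,
    lap_normSq_mul hh₁, hlapu]
  simp only [hlap₁ x hx]
  ring

/-- The eigenvalue problem reduces to an Euler equation for the harmonic part. -/
theorem exists_harmonic_euler_equation (hn : n ≠ 0) {β ς : ℝ} (hu : ContDiff ℝ ∞ u)
    (hbih : ∀ x ∈ Metric.ball 0 1, lap (lap u) x = 0)
    (hbd1 : ∀ y, ‖y‖ = 1 → euler u y = 0)
    (hbd2 : ∀ y, ‖y‖ = 1 →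
      euler (lap u) y + β * (lap u y - euler (euler u) y) + ς * u y = 0) :
    ∃ h : EuclideanSpace ℝ (Fin n) → ℝ, ContDiff ℝ ∞ h ∧
      (∀ x ∈ Metric.ball 0 1, lap h x = 0) ∧
      (∀ x ∈ Metric.closedBall 0 1, u x = h x - (‖x‖ ^ 2 - 1) * euler h x / 2) ∧
      ∀ x ∈ Metric.closedBall 0 1, 2 * euler (euler (euler h)) x +
        (n + β) * euler (euler h) x + β * (n - 2) * euler h x = ς * h x := by
  obtain ⟨h₀, h₁, hh₀, hh₁, hlap₀, hlap₁, hu_eq, hlapu⟩ := exists_almansi_decomposition hn hu hbih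
  have he₀ := contDiff_euler hh₀
  have he₁ := contDiff_euler hh₁
  have hee₀ := contDiff_euler he₀
  have heee₀ := contDiff_euler hee₀
  have d {f : EuclideanSpace ℝ (Fin n) → ℝ} (hf : ContDiff ℝ ∞ f) := differentiable_of_smooth hf
  have hsq : ContDiff ℝ ∞ fun x : EuclideanSpace ℝ (Fin n) => ‖x‖ ^ 2 := contDiff_normSq
  have c (a : ℝ) {f : EuclideanSpace ℝ (Fin n) → ℝ} (hf : ContDiff ℝ ∞ f) :
      ContDiff ℝ ∞ fun x => a * f x := contDiff_const.mul hf
  have heu : euler u = fun x => euler h₀ x +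
      ((‖x‖ ^ 2 * euler h₁ x + 2 * (‖x‖ ^ 2 * h₁ x)) + -1 * euler h₁ x) := by
    rw [hu_eq, euler_add (d hh₀) (d ((hsq.mul hh₁).add (c _ hh₁))),
      euler_add (d (hsq.mul hh₁)) (d (c _ hh₁)), euler_mul (d hsq) (d hh₁), euler_normSq,
      euler_const_mul (d hh₁)]
    funext x
    ring
  have hsubst : Set.EqOn h₁ (fun x => -(1 / 2) * euler h₀ x) (Metric.closedBall 0 1) := by
    intro x hx
    have hw : euler h₀ x + 2 * h₁ x = 0 := by
      refine eq_zero_of_lap_eq_zero hn (h := fun x => euler h₀ x + 2 * h₁ x)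
        (he₀.add (c _ hh₁)) ?_ ?_ hx
      · intro y hy
        rw [lap_add he₀ (c _ hh₁), lap_const_mul hh₁]
        simp only [lap_euler_eq_zero hh₀ hlap₀ y hy, hlap₁ y hy]
        ring
      · intro y hy
        have := hbd1 y hy
        rw [heu] at this
        simp only [hy] at this
        linarith
    simp only
    linarith
  have hsubst' : Set.EqOn (euler h₁) (fun x => -(1 / 2) * euler (euler h₀) x)
      (Metric.closedBall 0 1) := by
    have := eqOn_euler_closedBall hh₁ (c (-(1 / 2)) he₀) hsubst
    rwa [euler_const_mul (d he₀)] at this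
  have hsubst'' : Set.EqOn (euler (euler h₁)) (fun x => -(1 / 2) * euler (euler (euler h₀)) x)
      (Metric.closedBall 0 1) := by
    have := eqOn_euler_closedBall he₁ (c (-(1 / 2)) hee₀) hsubst'
    rwa [euler_const_mul (d hee₀)] at this
  refine ⟨h₀, hh₀, hlap₀, fun x hx => ?_, fun x hx => ?_⟩
  · rw [hu_eq]
    simp only [hsubst hx]
    ring
  have hK : 2 * euler (euler (euler h₀)) x + ((n + β) * euler (euler h₀) x +
      (β * (n - 2) * euler h₀ x + -ς * h₀ x)) = 0 := by
    refine eq_zero_of_lap_eq_zero hn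
      (h := fun x => 2 * euler (euler (euler h₀)) x + ((n + β) * euler (euler h₀) x +
        (β * (n - 2) * euler h₀ x + -ς * h₀ x)))
      ((c _ heee₀).add ((c _ hee₀).add ((c _ he₀).add (c _ hh₀)))) ?_ ?_ hx
    · intro y hy
      have l₁ := lap_euler_eq_zero hh₀ hlap₀
      have l₂ := lap_euler_eq_zero he₀ l₁
      have l₃ := lap_euler_eq_zero hee₀ l₂
      rw [lap_add (c _ heee₀) ((c _ hee₀).add ((c _ he₀).add (c _ hh₀))),
        lap_add (c _ hee₀) ((c _ he₀).add (c _ hh₀)), lap_add (c _ he₀) (c _ hh₀),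
        lap_const_mul heee₀, lap_const_mul hee₀, lap_const_mul he₀, lap_const_mul hh₀]
      simp only [hlap₀ y hy, l₁ y hy, l₂ y hy, l₃ y hy]
      ring
    · intro y hy
      have hy' : y ∈ Metric.closedBall 0 1 := by simp [hy]
      have hb := hbd2 y hy
      have heeu : euler (euler u) y = euler (euler h₀) y + 4 * h₁ y + 4 * euler h₁ y := by
        rw [heu, euler_add (d he₀)
            (d (((hsq.mul he₁).add (c 2 (hsq.mul hh₁))).add (c (-1) he₁))),
          euler_add (d ((hsq.mul he₁).add (c 2 (hsq.mul hh₁)))) (d (c (-1) he₁)),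
          euler_add (d (hsq.mul he₁)) (d (c 2 (hsq.mul hh₁))), euler_mul (d hsq) (d he₁),
          euler_const_mul (d (hsq.mul hh₁)), euler_mul (d hsq) (d hh₁), euler_normSq,
          euler_const_mul (d he₁)]
        simp only [hy]
        ring
      have helap : euler (lap u) y = 2 * n * euler h₁ y + 4 * euler (euler h₁) y := by
        rw [hlapu, euler_add (d (c _ hh₁)) (d (c _ he₁)), euler_const_mul (d hh₁),
          euler_const_mul (d he₁)]
      rw [heeu, helap, hlapu, hu_eq] at hb
      simp only [hy, hsubst hy', hsubst' hy', hsubst'' hy'] at hb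
      linarith
  linarith

end Almansi

section TaylorPolynomial

variable {n : ℕ} {f : EuclideanSpace ℝ (Fin n) → ℝ}

/-- The degree `k` homogeneous part of the Taylor expansion of `f` at the origin. -/
noncomputable def taylorPart (k : ℕ) (f : EuclideanSpace ℝ (Fin n) → ℝ) :
    MvPolynomial (Fin n) ℝ :=
  ∑ r : Fin k → Fin n, MvPolynomial.C
    (iteratedFDeriv ℝ k f 0 (fun i => EuclideanSpace.single (r i) 1) / k.factorial) *
      ∏ i, MvPolynomial.X (r i)

theorem taylorPart_isHomogeneous (k : ℕ) (f : EuclideanSpace ℝ (Fin n) → ℝ) :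
    (taylorPart k f).IsHomogeneous k := by
  refine MvPolynomial.IsHomogeneous.sum _ _ _ fun r _ => ?_
  refine MvPolynomial.IsHomogeneous.C_mul ?_ _
  simpa using MvPolynomial.IsHomogeneous.prod Finset.univ _ (fun _ => 1)
    fun i _ => MvPolynomial.isHomogeneous_X ℝ (r i)

theorem eval_taylorPart (hf : ContDiff ℝ ∞ f) (k : ℕ) (x : EuclideanSpace ℝ (Fin n)) :
    MvPolynomial.eval x (taylorPart k f) =
      iteratedDeriv k (fun r : ℝ => f (r • x)) 0 / k.factorial := by
  have hx : x = ∑ i, x i • EuclideanSpace.single i (1 : ℝ) := by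
    simpa using ((EuclideanSpace.basisFun (Fin n) ℝ).sum_repr x).symm
  have h₁ : iteratedDeriv k (fun r : ℝ => f (r • x)) 0 = iteratedFDeriv ℝ k f 0 fun _ => x := by
    have := (ContinuousLinearMap.toSpanSingleton ℝ x).iteratedFDeriv_comp_right
      (hf.of_le (by exact_mod_cast le_top : (k : WithTop ℕ∞) ≤ ∞)) 0 (i := k) le_rfl
    rw [iteratedDeriv_eq_iteratedFDeriv]
    simpa [Function.comp_def] using congrArg (fun T => T fun _ => (1 : ℝ)) this
  rw [h₁]
  nth_rewrite 2 [hx]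
  rw [ContinuousMultilinearMap.map_sum, Finset.sum_div]
  simp_rw [ContinuousMultilinearMap.map_smul_univ]
  simp only [taylorPart, map_sum, map_mul, MvPolynomial.eval_C, map_prod, MvPolynomial.eval_X,
    smul_eq_mul]
  exact Finset.sum_congr rfl fun r _ => by ring

theorem lineEuler_comp_smul (hf : Differentiable ℝ f) (x : EuclideanSpace ℝ (Fin n)) :
    lineEuler (fun r => f (r • x)) = fun r => euler f (r • x) := by
  funext r
  have h : HasDerivAt (fun r : ℝ => f (r • x)) (fderiv ℝ f (r • x) ((1 : ℝ) • x)) r :=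
    (hf (r • x)).hasFDerivAt.comp_hasDerivAt r ((hasDerivAt_id r).smul_const x)
  rw [lineEuler, h.deriv, euler, map_smul, map_smul, one_smul, smul_eq_mul]

theorem lap_comp_smul (hf : ContDiff ℝ ∞ f) (t : ℝ) (x : EuclideanSpace ℝ (Fin n)) :
    lap (fun y => f (t • y)) x = t ^ 2 * lap f (t • x) := by
  have h {g : EuclideanSpace ℝ (Fin n) → ℝ} (hg : Differentiable ℝ g) (i : Fin n) :
      partialDeriv i (fun y => g (t • y)) = fun y => t * partialDeriv i g (t • y) := by
    funext y
    have hd : HasFDerivAt (fun y => g (t • y)) _ y :=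
      (hg (t • y)).hasFDerivAt.comp y ((hasFDerivAt_id y).const_smul t)
    rw [partialDeriv, hd.fderiv]
    simp [partialDeriv]
  rw [lap_eq_sum_partialDeriv, lap_eq_sum_partialDeriv, Finset.mul_sum]
  refine Finset.sum_congr rfl fun i _ => ?_
  have hp := contDiff_partialDeriv hf i
  rw [h (differentiable_of_smooth hf), partialDeriv_const_mul, h (differentiable_of_smooth hp)]
  · ring
  · exact (differentiable_of_smooth hp).comp (differentiable_id.const_smul t)

variable {P : MvPolynomial (Fin n) ℝ} {k : ℕ}

theorem contDiff_eval (P : MvPolynomial (Fin n) ℝ) :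
    ContDiff ℝ ∞ fun x : EuclideanSpace ℝ (Fin n) => MvPolynomial.eval x P := by
  induction P using MvPolynomial.induction_on with
  | C a => simpa using contDiff_const
  | add p q hp hq => simpa using hp.add hq
  | mul_X p i hp => simpa using hp.mul (EuclideanSpace.proj (𝕜 := ℝ) i).contDiff

theorem eval_smul_of_isHomogeneous (hP : P.IsHomogeneous k) (t : ℝ)
    (x : EuclideanSpace ℝ (Fin n)) :
    MvPolynomial.eval (t • x) P = MvPolynomial.eval x P * t ^ k := by
  rw [MvPolynomial.eval_eq', MvPolynomial.eval_eq', Finset.sum_mul]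
  refine Finset.sum_congr rfl fun d hd => ?_
  have hk : ∑ i, d i = k := by
    rw [← hP (MvPolynomial.mem_support_iff.1 hd), Finsupp.weight_apply,
      Finsupp.sum_fintype _ _ (by simp)]
    simp
  simp only [PiLp.smul_apply, smul_eq_mul, mul_pow, Finset.prod_mul_distrib,
    Finset.prod_pow_eq_pow_sum, hk]
  ring

theorem euler_eval (hP : P.IsHomogeneous k) (x : EuclideanSpace ℝ (Fin n)) :
    euler (fun y => MvPolynomial.eval y P) x = k * MvPolynomial.eval x P := by
  have h := congrFun (lineEuler_comp_smul (differentiable_of_smooth (contDiff_eval P)) x) 1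
  simp_rw [one_smul, eval_smul_of_isHomogeneous hP] at h
  rw [← h, lineEuler_const_mul_pow]
  ring

theorem lap_eval_eq_zero (hP : P.IsHomogeneous k)
    (hlap : ∀ x ∈ Metric.ball 0 1, lap (fun y => MvPolynomial.eval y P) x = 0)
    (x : EuclideanSpace ℝ (Fin n)) : lap (fun y => MvPolynomial.eval y P) x = 0 := by
  have hq := contDiff_eval P
  obtain ⟨t, ht0, ht⟩ : ∃ t : ℝ, 0 < t ∧ t * ‖x‖ < 1 :=
    ⟨(‖x‖ + 1)⁻¹, by positivity, by
      rw [inv_mul_lt_iff₀ (by positivity)]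
      linarith⟩
  have h₁ := lap_comp_smul hq t x
  rw [hlap (t • x) (by simpa [norm_smul, abs_of_pos ht0] using ht), mul_zero] at h₁
  simp_rw [eval_smul_of_isHomogeneous hP, mul_comm _ (t ^ k)] at h₁
  rw [lap_const_mul hq] at h₁
  exact (mul_eq_zero.1 h₁).resolve_left (pow_ne_zero _ ht0.ne')

end TaylorPolynomial

section Classification

variable {n : ℕ} {u : EuclideanSpace ℝ (Fin n) → ℝ}

theorem strictMono_wentzellSymbol (hn : 2 ≤ n) {β : ℝ} (hβ : 0 ≤ β) :
    StrictMono fun j : ℕ => 2 * (j : ℝ) ^ 3 + (n + β) * (j : ℝ) ^ 2 + β * (n - 2) * j := by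
  intro i j hij
  have hn' : (2 : ℝ) ≤ n := by exact_mod_cast hn
  have hij' : (i : ℝ) < j := by exact_mod_cast hij
  have hi : (0 : ℝ) ≤ i := Nat.cast_nonneg i
  have h₁ : (i : ℝ) ^ 3 < (j : ℝ) ^ 3 := by gcongr
  have h₂ : (n + β) * (i : ℝ) ^ 2 ≤ (n + β) * (j : ℝ) ^ 2 := by gcongr
  have h₃ : β * (n - 2) * (i : ℝ) ≤ β * (n - 2) * j :=
    mul_le_mul_of_nonneg_left hij'.le (mul_nonneg hβ (by linarith))
  simp only
  linarith

theorem wentzell_classification_of_smooth (hn : 2 ≤ n) {β ς : ℝ} (hβ : 0 ≤ β)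
    (hu : ContDiff ℝ ∞ u)
    (hne : ∃ x ∈ Metric.closedBall 0 1, u x ≠ 0)
    (hbih : ∀ x ∈ Metric.ball 0 1, lap (lap u) x = 0)
    (hbd1 : ∀ y, ‖y‖ = 1 → euler u y = 0)
    (hbd2 : ∀ y, ‖y‖ = 1 →
      euler (lap u) y + β * (lap u y - euler (euler u) y) + ς * u y = 0) :
    ∃ (k : ℕ) (P : MvPolynomial (Fin n) ℝ), P.IsHomogeneous k ∧
      (∀ x : EuclideanSpace ℝ (Fin n), lap (fun y => MvPolynomial.eval y P) x = 0) ∧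
      ς = (k : ℝ) ^ 2 * ((n : ℝ) + 2 * (k : ℝ)) +
        β * (k : ℝ) * ((k : ℝ) + (n : ℝ) - 2) ∧
      ∀ x : EuclideanSpace ℝ (Fin n), ‖x‖ ≤ 1 →
        u x = -2 * MvPolynomial.eval x P +
          (k : ℝ) * (‖x‖ ^ 2 - 1) * MvPolynomial.eval x P := by
  obtain ⟨h, hh, hlap, hu_eq, heq⟩ :=
    exists_harmonic_euler_equation (by lia) hu hbih hbd1 hbd2
  have he := contDiff_euler hh
  have hee := contDiff_euler he
  have hray (k : ℕ)
      (hk : ∀ j : ℕ, 2 * (j : ℝ) ^ 3 + (n + β) * (j : ℝ) ^ 2 + β * (n - 2) * j = ς → j = k)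
      (x : EuclideanSpace ℝ (Fin n)) (hx : x ∈ Metric.closedBall 0 1) :
      (2 * (k : ℝ) ^ 3 + (n + β) * (k : ℝ) ^ 2 + β * (n - 2) * k - ς) * h x = 0 ∧
        h x = MvPolynomial.eval x (taylorPart k h) := by
    have hf : ContDiff ℝ ∞ fun r : ℝ => h (r • x) :=
      hh.comp (contDiff_id.smul contDiff_const)
    obtain ⟨h₁, h₂⟩ := eq_mul_pow_of_lineEuler hf two_ne_zero (fun r hr => by
      rw [lineEuler_comp_smul (differentiable_of_smooth hh),
        lineEuler_comp_smul (differentiable_of_smooth he),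
        lineEuler_comp_smul (differentiable_of_smooth hee)]
      refine heq (r • x) ?_
      rw [mem_closedBall_zero_iff] at hx ⊢
      rw [norm_smul]
      exact mul_le_one₀ (abs_le.2 hr) (norm_nonneg x) hx) k hk
    have h₃ := h₂ 1 (by simp)
    rw [one_smul, one_pow, mul_one] at h₃
    rw [eval_taylorPart hh, ← h₃]
    exact ⟨by rw [h₃, ← mul_div_assoc, h₁, zero_div], rfl⟩
  obtain ⟨k, hk⟩ :
      ∃ k : ℕ, 2 * (k : ℝ) ^ 3 + (n + β) * (k : ℝ) ^ 2 + β * (n - 2) * k = ς := by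
    by_contra! hno
    obtain ⟨x, hx, hux⟩ := hne
    have hzero : Set.EqOn h (fun _ => 0) (Metric.closedBall 0 1) := fun y hy =>
      (mul_eq_zero.1 (hray 0 (fun j hj => absurd hj (hno j)) y hy).1).resolve_left
        (sub_ne_zero.2 (hno 0))
    have hezero := eqOn_euler_closedBall hh contDiff_const hzero hx
    rw [show euler (fun _ : EuclideanSpace ℝ (Fin n) => (0 : ℝ)) x = 0 by simp [euler]] at hezero
    apply hux
    rw [hu_eq x hx, hzero hx, hezero]
    ring
  have hpoly : Set.EqOn h (fun x => MvPolynomial.eval x (taylorPart k h))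
      (Metric.closedBall 0 1) := fun x hx =>
    (hray k (fun j hj =>
      (strictMono_wentzellSymbol hn hβ).injective (hj.trans hk.symm)) x hx).2
  have hhom := taylorPart_isHomogeneous k h
  have hcd := contDiff_eval (taylorPart k h)
  have hsmul : (fun y : EuclideanSpace ℝ (Fin n) =>
      MvPolynomial.eval y (MvPolynomial.C (-(1 / 2)) * taylorPart k h)) =
      fun y : EuclideanSpace ℝ (Fin n) => -(1 / 2) * MvPolynomial.eval y (taylorPart k h) := by
    simp
  refine ⟨k, MvPolynomial.C (-(1 / 2)) * taylorPart k h, hhom.C_mul _, ?_, ?_, ?_⟩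
  · intro x
    rw [hsmul, lap_const_mul hcd]
    simp only
    rw [lap_eval_eq_zero hhom, mul_zero]
    intro y hy
    have hev : (fun x => MvPolynomial.eval x (taylorPart k h)) =ᶠ[nhds y] h :=
      Filter.eventually_of_mem (Metric.isOpen_ball.mem_nhds hy) fun z hz =>
        (hpoly (Metric.ball_subset_closedBall hz)).symm
    rw [(eventuallyEq_lap hev).self_of_nhds, hlap y hy]
  · rw [← hk]
    ring
  · intro x hx
    have hx' : x ∈ Metric.closedBall 0 1 := mem_closedBall_zero_iff.2 hx
    rw [hu_eq x hx', eqOn_euler_closedBall hh hcd hpoly hx', euler_eval hhom, hpoly hx',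
      congrFun hsmul x]
    ring

/-- A function smooth near the closed unit ball agrees near it with a globally smooth one. -/
theorem exists_contDiff_eventuallyEq {U : Set (EuclideanSpace ℝ (Fin n))} (hU : IsOpen U)
    (hsub : Metric.closedBall 0 1 ⊆ U) (hu : ContDiffOn ℝ ∞ u U) :
    ∃ v : EuclideanSpace ℝ (Fin n) → ℝ, ContDiff ℝ ∞ v ∧
      ∀ x ∈ Metric.closedBall 0 1, u =ᶠ[nhds x] v := by
  obtain ⟨δ, hδ, hsubδ⟩ :=
    (isCompact_closedBall (0 : EuclideanSpace ℝ (Fin n)) 1).exists_cthickening_subset_open hU hsub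
  rw [cthickening_closedBall hδ.le zero_le_one] at hsubδ
  let χ : ContDiffBump (0 : EuclideanSpace ℝ (Fin n)) :=
    ⟨1 + δ / 2, 1 + δ, by positivity, by linarith⟩
  refine ⟨fun x => χ x * u x, contDiff_iff_contDiffAt.2 fun x => ?_, fun x hx => ?_⟩
  · by_cases hx : x ∈ tsupport χ
    · have hxU : x ∈ U := hsubδ (by
        rw [χ.tsupport_eq] at hx
        rwa [add_comm δ])
      exact χ.contDiffAt.mul (hu.contDiffAt (hU.mem_nhds hxU))
    · refine (contDiffAt_const (c := (0 : ℝ))).congr_of_eventuallyEq ?_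
      filter_upwards [notMem_tsupport_iff_eventuallyEq.1 hx] with y hy
      simp [hy]
  · rw [mem_closedBall_zero_iff] at hx
    have hmem : x ∈ Metric.ball (0 : EuclideanSpace ℝ (Fin n)) χ.rIn :=
      mem_ball_zero_iff.2 (hx.trans_lt (show (1 : ℝ) < 1 + δ / 2 by linarith))
    filter_upwards [χ.eventuallyEq_one_of_mem_ball hmem] with y hy
    simp [hy]

end Classification

/-- Theorem 1.5, classification of eigenfunctions: If `n ≥ 2`, `β ≥ 0`,
`ς ∈ ℝ`, and `u` is a nonzero smooth function on an open set containing the closed unit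
ball of `ℝⁿ` with `Δ²u = 0` in the open unit ball, `ℰu = 0` on the unit sphere, and
`ℰ(Δu) + β(Δu - ℰ²u) + ς·u = 0` on the unit sphere, then there are a nonnegative integer
`k` and a harmonic homogeneous polynomial `w_k` of degree `k` such that
`ς = k²(n+2k) + βk(k+n-2)` and `u(x) = -2w_k(x) + k(|x|² - 1)w_k(x)` on the closed ball. -/
theorem wentzell_eigenfunction_classification (n : ℕ) (hn : 2 ≤ n) (β ς : ℝ) (hβ : 0 ≤ β)
    (U : Set (EuclideanSpace ℝ (Fin n))) (hU : IsOpen U)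
    (hsub : Metric.closedBall (0 : EuclideanSpace ℝ (Fin n)) 1 ⊆ U)
    (u : EuclideanSpace ℝ (Fin n) → ℝ) (hu : ContDiffOn ℝ (⊤ : ℕ∞) u U)
    (hne : ∃ x ∈ Metric.closedBall (0 : EuclideanSpace ℝ (Fin n)) 1, u x ≠ 0)
    (hbih : ∀ x ∈ Metric.ball (0 : EuclideanSpace ℝ (Fin n)) 1, lap (lap u) x = 0)
    (hbd1 : ∀ y : EuclideanSpace ℝ (Fin n), ‖y‖ = 1 → euler u y = 0)
    (hbd2 : ∀ y : EuclideanSpace ℝ (Fin n), ‖y‖ = 1 →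
      euler (lap u) y + β * (lap u y - euler (euler u) y) + ς * u y = 0) :
    ∃ (k : ℕ) (P : MvPolynomial (Fin n) ℝ), P.IsHomogeneous k ∧
      (∀ x : EuclideanSpace ℝ (Fin n), lap (fun y => MvPolynomial.eval y P) x = 0) ∧
      ς = (k : ℝ) ^ 2 * ((n : ℝ) + 2 * (k : ℝ)) +
        β * (k : ℝ) * ((k : ℝ) + (n : ℝ) - 2) ∧
      ∀ x : EuclideanSpace ℝ (Fin n), ‖x‖ ≤ 1 →
        u x = -2 * MvPolynomial.eval x P +
          (k : ℝ) * (‖x‖ ^ 2 - 1) * MvPolynomial.eval x P := by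
  obtain ⟨v, hv, huv⟩ := exists_contDiff_eventuallyEq hU hsub hu
  have hsphere {y : EuclideanSpace ℝ (Fin n)} (hy : ‖y‖ = 1) : u =ᶠ[nhds y] v :=
    huv y (mem_closedBall_zero_iff.2 hy.le)
  obtain ⟨k, P, hP, hlapP, hς, hform⟩ := wentzell_classification_of_smooth (ς := ς) hn hβ hv
    (by
      obtain ⟨x, hx, hux⟩ := hne
      exact ⟨x, hx, by rwa [← (huv x hx).self_of_nhds]⟩)
    (fun x hx => by
      rw [← hbih x hx]
      exact (eventuallyEq_lap (eventuallyEq_lap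
        (huv x (Metric.ball_subset_closedBall hx)))).self_of_nhds.symm)
    (fun y hy => by rw [← hbd1 y hy, (eventuallyEq_euler (hsphere hy)).self_of_nhds])
    (fun y hy => by
      have h := hsphere hy
      rw [← hbd2 y hy, (eventuallyEq_euler (eventuallyEq_lap h)).self_of_nhds,
        (eventuallyEq_lap h).self_of_nhds,
        (eventuallyEq_euler (eventuallyEq_euler h)).self_of_nhds, h.self_of_nhds])
  refine ⟨k, P, hP, hlapP, hς, fun x hx => ?_⟩
  rw [(huv x (mem_closedBall_zero_iff.2 hx)).self_of_nhds, hform x hx]
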